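/- arXiv:1512.08673 — 2 statements merged into one kernel-verified Lean document; each statement's English description precedes it below -/
import Mathlib

section
/- Let 𝒩_1, …, 𝒩_l be subsets of 𝒩 = {1,…,n} whose union is 𝒩 and which form a laminar (tree-structured) family: 𝒩_i ∩ 𝒩_j ≠ ∅ implies 𝒩_i ⊆ 𝒩_j or 𝒩_j ⊆ 𝒩_i. For each i let ‖·‖_i be an arbitrary norm on ℝ^{|𝒩_i|}, and define ‖z‖_A := Σ_{i=1}^l ‖z_{𝒩_i}‖_i. Then: (i) the maximal sets of the family (those 𝒩_i not strictly contained in any 𝒩_j), after removing duplicates, are pairwise disjoint and form a partition 𝒢 = {G_1,…,G_g} of 𝒩, with each 𝒩_j contained in exactly one G_i; and (ii) the norm ‖·‖_A is decomposable with respect to 𝒢: whenever supp(u) ⊆ ⋃_{i∈S_u} G_i and supp(v) ⊆ ⋃_{i∈S_v} G_i for disjoint subsets S_u, S_v of {1,…,g}, one has ‖u+v‖_A = ‖u‖_A + ‖v‖_A. -/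
noncomputable section

open Finset

/-- The restriction `x_Λ` of `x : ℝ^n` to the coordinates in `Λ` (zero outside `Λ`). -/
def restr {n : ℕ} (Λ : Finset (Fin n)) (x : Fin n → ℝ) : Fin n → ℝ :=
  fun i => if i ∈ Λ then x i else 0

/-- Restriction to a set of coordinates is additive. -/
theorem restr_add {n : ℕ} (Λ : Finset (Fin n)) (x y : Fin n → ℝ) :
    restr Λ (x + y) = restr Λ x + restr Λ y := by
  ext i
  by_cases hi : i ∈ Λ <;> simp [restr, hi]

/-- Restricting to coordinates disjoint from the support gives zero. -/
theorem restr_eq_zero {n : ℕ} {Λ Γ : Finset (Fin n)} {x : Fin n → ℝ}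
    (hx : Function.support x ⊆ ↑Γ) (hΛ : Disjoint Λ Γ) : restr Λ x = 0 := by
  ext i
  by_cases hi : i ∈ Λ
  · have : x i = 0 := by
      by_contra h
      exact Finset.disjoint_left.mp hΛ hi (Finset.mem_coe.mp (hx h))
    simp [restr, hi, this]
  · simp [restr, hi]

/-- A block of a pairwise disjoint family is disjoint from any union of other blocks. -/
theorem disjoint_biUnion_of_notMem {ι α : Type*} [DecidableEq α] {G : ι → Finset α}
    (hG : ∀ i i', i ≠ i' → Disjoint (G i) (G i')) {S : Finset ι} {i : ι} (hi : i ∉ S) :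
    Disjoint (G i) (S.biUnion G) :=
  (Finset.disjoint_biUnion_right _ _ _).mpr fun k hk => hG i k fun h => hi (h ▸ hk)

/-- The sum of seminorm-like functions of restrictions is additive on vectors supported on
disjoint unions of blocks, as soon as each restriction set lies in a single block. -/
theorem sum_restr_add {n : ℕ} {ι κ : Type*} [Fintype ι] {𝒩 : ι → Finset (Fin n)}
    {p : ι → (Fin n → ℝ) → ℝ} (hp : ∀ i, p i 0 = 0) {G : κ → Finset (Fin n)}
    (hG : ∀ i i', i ≠ i' → Disjoint (G i) (G i')) (h𝒩 : ∀ j, ∃ i, 𝒩 j ⊆ G i)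
    {u v : Fin n → ℝ} {Su Sv : Finset κ} (hS : Disjoint Su Sv)
    (hu : Function.support u ⊆ ↑(Su.biUnion G)) (hv : Function.support v ⊆ ↑(Sv.biUnion G)) :
    ∑ j, p j (restr (𝒩 j) (u + v)) =
      ∑ j, p j (restr (𝒩 j) u) + ∑ j, p j (restr (𝒩 j) v) := by
  rw [← Finset.sum_add_distrib]
  refine Finset.sum_congr rfl fun j _ => ?_
  obtain ⟨i, hi⟩ := h𝒩 j
  rw [restr_add]
  by_cases hiu : i ∈ Su
  · have hiv : i ∉ Sv := Finset.disjoint_left.mp hS hiu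
    rw [restr_eq_zero hv ((disjoint_biUnion_of_notMem hG hiv).mono_left hi)]
    simp [hp]
  · rw [restr_eq_zero hu ((disjoint_biUnion_of_notMem hG hiu).mono_left hi)]
    simp [hp]

/-- Every member of a finite family of sets is contained in a maximal one. -/
theorem exists_subset_maximal {ι α : Type*} [Finite ι] (𝒩 : ι → Finset α) (j : ι) :
    ∃ k, 𝒩 j ⊆ 𝒩 k ∧ ∀ k', 𝒩 k ⊆ 𝒩 k' → 𝒩 k' = 𝒩 k := by
  obtain ⟨m, hjm, ⟨k, rfl⟩, hmax⟩ :=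
    (Set.finite_range 𝒩).exists_le_maximal (Set.mem_range_self j)
  exact ⟨k, hjm, fun k' hk => (hmax (Set.mem_range_self k') hk).antisymm hk⟩

/-- for a laminar (tree-structured) family `𝒩_1,…,𝒩_l` covering `{1,…,n}`,
the maximal sets of the family form a partition `𝒢 = {G_1,…,G_g}`, each `𝒩_j` is contained
in exactly one `G_i`, and the norm `‖z‖_A = Σ_i ‖z_{𝒩_i}‖_i` is decomposable w.r.t. `𝒢`. -/
theorem stmt3 {n l : ℕ}
    (𝒩 : Fin l → Finset (Fin n))
    (hne : ∀ i, (𝒩 i).Nonempty)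
    (hcover : Finset.univ.biUnion 𝒩 = (Finset.univ : Finset (Fin n)))
    -- laminar (tree-structured) condition
    (hlam : ∀ i j, (𝒩 i ∩ 𝒩 j).Nonempty → 𝒩 i ⊆ 𝒩 j ∨ 𝒩 j ⊆ 𝒩 i)
    -- `Ni i` is an arbitrary norm, used on vectors supported in `𝒩 i`
    (Ni : Fin l → (Fin n → ℝ) → ℝ)
    (hNi_add : ∀ i (u v : Fin n → ℝ), Ni i (u + v) ≤ Ni i u + Ni i v)
    (hNi_smul : ∀ i (t : ℝ) (u : Fin n → ℝ), Ni i (t • u) = |t| * Ni i u)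
    (hNi_def : ∀ i (u : Fin n → ℝ), Ni i u = 0 ↔ u = 0)
    -- the norm `‖z‖_A := Σ_i ‖z_{𝒩_i}‖_i`
    (NA : (Fin n → ℝ) → ℝ)
    (hNA : ∀ z, NA z = ∑ i, Ni i (restr (𝒩 i) z)) :
    ∃ (g : ℕ) (G : Fin g → Finset (Fin n)),
      -- the `G i` enumerate, without duplicates, exactly the maximal sets of the family
      Function.Injective G ∧
      (∀ i, ∃ j, G i = 𝒩 j ∧ ∀ j', 𝒩 j ⊆ 𝒩 j' → 𝒩 j' = 𝒩 j) ∧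
      (∀ j, (∀ j', 𝒩 j ⊆ 𝒩 j' → 𝒩 j' = 𝒩 j) → ∃ i, G i = 𝒩 j) ∧
      -- (i) they are pairwise disjoint and partition `{1,…,n}`,
      (∀ i i' : Fin g, i ≠ i' → Disjoint (G i) (G i')) ∧
      Finset.univ.biUnion G = (Finset.univ : Finset (Fin n)) ∧
      -- and each `𝒩_j` is contained in exactly one `G i`
      (∀ j, ∃! i, 𝒩 j ⊆ G i) ∧
      -- (ii) the norm `‖·‖_A` is decomposable with respect to `𝒢 = {G_1,…,G_g}`
      (∀ (u v : Fin n → ℝ) (Su Sv : Finset (Fin g)), Disjoint Su Sv →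
        Function.support u ⊆ ↑(Su.biUnion G) → Function.support v ⊆ ↑(Sv.biUnion G) →
        NA (u + v) = NA u + NA v) := by
  classical
  let M : Finset (Finset (Fin n)) :=
    (Finset.univ.filter fun j => ∀ j', 𝒩 j ⊆ 𝒩 j' → 𝒩 j' = 𝒩 j).image 𝒩
  let G : Fin M.card → Finset (Fin n) := fun i => (M.equivFin.symm i).1
  have hinj : Function.Injective G := Subtype.val_injective.comp M.equivFin.symm.injective
  have hmax : ∀ i, ∃ j, G i = 𝒩 j ∧ ∀ j', 𝒩 j ⊆ 𝒩 j' → 𝒩 j' = 𝒩 j := by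
    intro i
    obtain ⟨j, hj, hji⟩ := Finset.mem_image.mp (M.equivFin.symm i).2
    exact ⟨j, hji.symm, (Finset.mem_filter.mp hj).2⟩
  have hsurj : ∀ j, (∀ j', 𝒩 j ⊆ 𝒩 j' → 𝒩 j' = 𝒩 j) → ∃ i, G i = 𝒩 j := by
    intro j hj
    have hjM : 𝒩 j ∈ M :=
      Finset.mem_image_of_mem _ (Finset.mem_filter.mpr ⟨Finset.mem_univ j, hj⟩)
    exact ⟨M.equivFin ⟨𝒩 j, hjM⟩, by simp [G]⟩
  have hdisj : ∀ i i', i ≠ i' → Disjoint (G i) (G i') := by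
    intro i i' hii'
    obtain ⟨j, hj, hjmax⟩ := hmax i
    obtain ⟨k, hk, hkmax⟩ := hmax i'
    by_contra h
    rw [hj, hk, Finset.not_disjoint_iff_nonempty_inter] at h
    refine hii' (hinj ?_)
    rw [hj, hk]
    rcases hlam j k h with hjk | hkj
    · exact (hjmax k hjk).symm
    · exact hkmax j hkj
  have hsub : ∀ j, ∃ i, 𝒩 j ⊆ G i := by
    intro j
    obtain ⟨k, hjk, hk⟩ := exists_subset_maximal 𝒩 j
    obtain ⟨i, hi⟩ := hsurj k hk
    exact ⟨i, hi ▸ hjk⟩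
  refine ⟨M.card, G, hinj, hmax, hsurj, hdisj, ?_, fun j => ?_, ?_⟩
  · refine Finset.eq_univ_of_forall fun x => ?_
    obtain ⟨j, -, hxj⟩ := Finset.mem_biUnion.mp (hcover ▸ Finset.mem_univ x)
    obtain ⟨i, hi⟩ := hsub j
    exact Finset.mem_biUnion.mpr ⟨i, Finset.mem_univ i, hi hxj⟩
  · obtain ⟨i, hi⟩ := hsub j
    refine ⟨i, hi, fun i' hi' => ?_⟩
    obtain ⟨x, hx⟩ := hne j
    by_contra h
    exact Finset.disjoint_left.mp (hdisj i' i h) (hi' hx) (hi hx)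
  · intro u v Su Sv hS hu hv
    rw [hNA, hNA, hNA]
    exact sum_restr_add (fun i => (hNi_def i 0).mpr rfl) hdisj hsub hS hu hv
end
end

section
/- Suppose A ∈ ℝ^{m×n} satisfies the restricted isometry property of order 2k with constant δ = δ_{2k} satisfying δ < √2 − 1. Let x ∈ ℝ^n, y = Ax + η with ‖η‖₂ ≤ ε, and let x̂ minimize ‖z‖₁ over all z ∈ ℝ^n with ‖y − Az‖₂ ≤ ε. Then ‖x̂ − x‖₂ ≤ (2/√k)·(1 + (√2−1)δ)/(1 − (1+√2)δ)·σ_k(x,‖·‖₁) + 4√(1+δ)/(1 − (1+√2)δ)·ε. -/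
noncomputable section

open Finset

/-- The Euclidean norm on `ℝ^n`. -/
def norm2 {n : ℕ} (x : Fin n → ℝ) : ℝ := Real.sqrt (∑ i, (x i) ^ 2)

/-- The ℓ₁-norm on `ℝ^n`. -/
def norm1 {n : ℕ} (x : Fin n → ℝ) : ℝ := ∑ i, |x i|

/-- `A` satisfies the restricted isometry property of order `t` with constant `δ`. -/
def RIP {m n : ℕ} (A : Matrix (Fin m) (Fin n) ℝ) (t : ℕ) (δ : ℝ) : Prop :=
  ∀ u : Fin n → ℝ, (Finset.univ.filter (fun i => u i ≠ 0)).card ≤ t →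
    (1 - δ) * (norm2 u) ^ 2 ≤ (norm2 (A.mulVec u)) ^ 2 ∧
    (norm2 (A.mulVec u)) ^ 2 ≤ (1 + δ) * (norm2 u) ^ 2

theorem norm2_eq_norm_toLp {n : ℕ} (x : Fin n → ℝ) : norm2 x = ‖WithLp.toLp 2 x‖ := by
  simp [norm2, EuclideanSpace.norm_eq]

theorem norm2_nonneg {n : ℕ} (x : Fin n → ℝ) : 0 ≤ norm2 x := Real.sqrt_nonneg _

theorem norm2_sq {n : ℕ} (x : Fin n → ℝ) : norm2 x ^ 2 = x ⬝ᵥ x := by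
  rw [norm2, Real.sq_sqrt (Finset.sum_nonneg fun i _ => sq_nonneg _)]
  simp [dotProduct, sq]

theorem norm2_add_le {n : ℕ} (x y : Fin n → ℝ) : norm2 (x + y) ≤ norm2 x + norm2 y := by
  simp only [norm2_eq_norm_toLp, WithLp.toLp_add]
  exact norm_add_le _ _

theorem norm2_sub_le {n : ℕ} (x y : Fin n → ℝ) : norm2 (x - y) ≤ norm2 x + norm2 y := by
  simp only [norm2_eq_norm_toLp, WithLp.toLp_sub]
  exact norm_sub_le _ _

theorem abs_dotProduct_le_norm2_mul {n : ℕ} (x y : Fin n → ℝ) :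
    |x ⬝ᵥ y| ≤ norm2 x * norm2 y := by
  apply abs_le_of_sq_le_sq _ (mul_nonneg (norm2_nonneg _) (norm2_nonneg _))
  rw [mul_pow, norm2_sq, norm2_sq]
  simpa [dotProduct, sq] using Finset.sum_mul_sq_le_sq_mul_sq Finset.univ x y

theorem restr_apply_of_notMem {n : ℕ} {S : Finset (Fin n)} {i : Fin n} (hi : i ∉ S)
    (h : Fin n → ℝ) : restr S h i = 0 := if_neg hi

theorem restr_add_restr_sdiff {n : ℕ} {T S : Finset (Fin n)} (hTS : T ⊆ S) (h : Fin n → ℝ) :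
    restr T h + restr (S \ T) h = restr S h := by
  ext i
  by_cases hT : i ∈ T
  · simp [restr, hT, hTS hT]
  · simp [restr, hT]

theorem norm2_restr_sq {n : ℕ} (S : Finset (Fin n)) (h : Fin n → ℝ) :
    norm2 (restr S h) ^ 2 = ∑ i ∈ S, h i ^ 2 := by
  rw [norm2_sq]
  simp [dotProduct, restr, sq]

theorem dotProduct_eq_zero_of_disjoint {n : ℕ} {U V : Finset (Fin n)} (hUV : Disjoint U V)
    {u v : Fin n → ℝ} (hu : ∀ i ∉ U, u i = 0) (hv : ∀ i ∉ V, v i = 0) : u ⬝ᵥ v = 0 := by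
  refine Finset.sum_eq_zero fun i _ => ?_
  by_cases hi : i ∈ U
  · rw [hv i (Finset.disjoint_left.mp hUV hi), mul_zero]
  · rw [hu i hi, zero_mul]

/-- A selection of at most `k` largest entries of `h` on `S`, with a threshold `M`. -/
theorem exists_largest_entries {n : ℕ} (h : Fin n → ℝ) (S : Finset (Fin n)) (k : ℕ) :
    ∃ T ⊆ S, T.card ≤ k ∧ ∃ M : ℝ, 0 ≤ M ∧ (∀ i ∈ S \ T, |h i| ≤ M) ∧
      k * M ≤ ∑ i ∈ T, |h i| := by
  induction k with
  | zero =>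
    refine ⟨∅, by simp, by simp, ∑ i ∈ S, |h i|, Finset.sum_nonneg fun i _ => abs_nonneg _,
      fun i hi => ?_, by simp⟩
    exact Finset.single_le_sum (f := fun i => |h i|) (fun i _ => abs_nonneg _)
      (Finset.mem_sdiff.mp hi).1
  | succ k ih =>
    obtain ⟨T, hTS, hTk, M, hM, hST, hsum⟩ := ih
    rcases (S \ T).eq_empty_or_nonempty with he | hne
    · exact ⟨T, hTS, by omega, 0, le_rfl, by simp [he],
        by simpa using Finset.sum_nonneg fun i _ => abs_nonneg (h i)⟩
    · obtain ⟨j, hj, hmax⟩ := Finset.exists_max_image (S \ T) (fun i => |h i|) hne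
      have hj' := Finset.mem_sdiff.mp hj
      refine ⟨insert j T, Finset.insert_subset hj'.1 hTS, ?_, |h j|, abs_nonneg _, ?_, ?_⟩
      · rw [Finset.card_insert_of_notMem hj'.2]; omega
      · intro i hi
        apply hmax
        simp only [Finset.mem_sdiff, Finset.mem_insert, not_or] at hi ⊢
        exact ⟨hi.1, hi.2.2⟩
      · rw [Finset.sum_insert hj'.2]
        have : (k : ℝ) * |h j| ≤ k * M := mul_le_mul_of_nonneg_left (hST j hj) k.cast_nonneg
        push_cast
        linarith

theorem norm2_restr_le_sqrt_mul {n k : ℕ} {T : Finset (Fin n)} (hT : T.card ≤ k)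
    {h : Fin n → ℝ} {M : ℝ} (hM : 0 ≤ M) (hh : ∀ i ∈ T, |h i| ≤ M) :
    norm2 (restr T h) ≤ Real.sqrt k * M := by
  apply le_of_pow_le_pow_left₀ two_ne_zero (by positivity)
  rw [norm2_restr_sq, mul_pow, Real.sq_sqrt k.cast_nonneg]
  calc ∑ i ∈ T, h i ^ 2 ≤ T.card • M ^ 2 :=
        Finset.sum_le_card_nsmul _ _ _ fun i hi => sq_le_sq' (abs_le.mp (hh i hi)).1
          (abs_le.mp (hh i hi)).2
    _ ≤ k * M ^ 2 := by
        rw [nsmul_eq_mul]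
        gcongr

/-- The shelling estimate: a linear functional bounded by `c` on `k`-sparse vectors supported in `S`
is bounded on `h_S` in terms of the largest entry and the `ℓ₁`-norm of `h_S`. -/
theorem abs_linear_restr_le {n k : ℕ} (hk : 0 < k) (h : Fin n → ℝ) (g : (Fin n → ℝ) →ₗ[ℝ] ℝ)
    {c : ℝ} (hc : 0 ≤ c) (S : Finset (Fin n))
    (hg : ∀ T ⊆ S, T.card ≤ k → |g (restr T h)| ≤ c * norm2 (restr T h))
    {M : ℝ} (hM : 0 ≤ M) (hh : ∀ i ∈ S, |h i| ≤ M) :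
    |g (restr S h)| ≤ c * (Real.sqrt k * M + (∑ i ∈ S, |h i|) / Real.sqrt k) := by
  have hk' : (0 : ℝ) < k := Nat.cast_pos.mpr hk
  have hs : 0 < Real.sqrt k := Real.sqrt_pos.mpr hk'
  induction S using Finset.strongInduction generalizing M with
  | H S ih =>
    obtain ⟨T, hTS, hTk, m, hm, hST, hsum⟩ := exists_largest_entries h S k
    rcases T.eq_empty_or_nonempty with rfl | hne
    · have hm0 : m = 0 := by
        simp only [Finset.sum_empty] at hsum
        nlinarith
      have hz : restr S h = 0 := by
        ext i
        by_cases hi : i ∈ S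
        · have := hST i (by simpa using hi)
          rw [hm0] at this
          simpa [restr, hi] using this
        · exact restr_apply_of_notMem hi h
      rw [hz, map_zero, abs_zero]
      positivity
    · have hss : S \ T ⊂ S := Finset.sdiff_ssubset hTS hne
      have h1 := ih (S \ T) hss (fun U hU => hg U (hU.trans Finset.sdiff_subset)) hm hST
      have h2 : |g (restr T h)| ≤ c * (Real.sqrt k * M) := (hg T hTS hTk).trans
        (mul_le_mul_of_nonneg_left
          (norm2_restr_le_sqrt_mul hTk hM fun i hi => hh i (hTS hi)) hc)
      have h3 : Real.sqrt k * m ≤ (∑ i ∈ T, |h i|) / Real.sqrt k := by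
        rw [le_div_iff₀ hs]
        nlinarith [Real.mul_self_sqrt hk'.le]
      have h4 := Finset.sum_sdiff (f := fun i => |h i|) hTS
      rw [← restr_add_restr_sdiff hTS, map_add]
      calc |g (restr T h) + g (restr (S \ T) h)|
          ≤ c * (Real.sqrt k * M) +
            c * (Real.sqrt k * m + (∑ i ∈ S \ T, |h i|) / Real.sqrt k) :=
            (abs_add_le _ _).trans (add_le_add h2 h1)
        _ ≤ c * (Real.sqrt k * M) +
            c * ((∑ i ∈ T, |h i|) / Real.sqrt k + (∑ i ∈ S \ T, |h i|) / Real.sqrt k) := by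
            gcongr
        _ = c * (Real.sqrt k * M + (∑ i ∈ S, |h i|) / Real.sqrt k) := by
            rw [← h4]; ring

/-- Off the `k` largest entries of `h_S`, a functional bounded by `c` on `k`-sparse vectors is
controlled by the `ℓ₁`-norm of `h_S`. -/
theorem exists_abs_linear_restr_sdiff_le {n k : ℕ} (hk : 0 < k) (h : Fin n → ℝ)
    (S : Finset (Fin n)) :
    ∃ T ⊆ S, T.card ≤ k ∧ ∀ (g : (Fin n → ℝ) →ₗ[ℝ] ℝ) (c : ℝ), 0 ≤ c →
      (∀ U ⊆ S \ T, U.card ≤ k → |g (restr U h)| ≤ c * norm2 (restr U h)) →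
      |g (restr (S \ T) h)| ≤ c * ((∑ i ∈ S, |h i|) / Real.sqrt k) := by
  have hk' : (0 : ℝ) < k := Nat.cast_pos.mpr hk
  have hs : 0 < Real.sqrt k := Real.sqrt_pos.mpr hk'
  obtain ⟨T, hTS, hTk, m, hm, hST, hsum⟩ := exists_largest_entries h S k
  refine ⟨T, hTS, hTk, fun g c hc hg => ?_⟩
  refine (abs_linear_restr_le hk h g hc (S \ T) hg hm hST).trans
    (mul_le_mul_of_nonneg_left ?_ hc)
  have h3 : Real.sqrt k * m ≤ (∑ i ∈ T, |h i|) / Real.sqrt k := by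
    rw [le_div_iff₀ hs]
    nlinarith [Real.mul_self_sqrt hk'.le]
  rw [← Finset.sum_sdiff (f := fun i => |h i|) hTS, add_div]
  linarith

/-- Vectors with disjoint sparse supports have almost orthogonal images under a RIP matrix. -/
theorem RIP.abs_dotProduct_le {m n k : ℕ} {A : Matrix (Fin m) (Fin n) ℝ} {δ : ℝ} (hδ : 0 ≤ δ)
    (hA : RIP A (2 * k) δ) {U V : Finset (Fin n)} (hUV : Disjoint U V) (hU : U.card ≤ k)
    (hV : V.card ≤ k) {u v : Fin n → ℝ} (hu : ∀ i ∉ U, u i = 0) (hv : ∀ i ∉ V, v i = 0) :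
    |A.mulVec u ⬝ᵥ A.mulVec v| ≤ δ * norm2 u * norm2 v := by
  have hsupp (t : ℝ) : (Finset.univ.filter fun i => (u + t • v) i ≠ 0).card ≤ 2 * k := by
    refine (Finset.card_le_card (t := U ∪ V) fun i hi => ?_).trans
      ((Finset.card_union_le _ _).trans (by omega))
    by_contra hn
    rw [Finset.mem_union, not_or] at hn
    simp [hu i hn.1, hv i hn.2] at hi
  have huv := dotProduct_eq_zero_of_disjoint hUV hu hv
  have hnorm (t : ℝ) : norm2 (u + t • v) ^ 2 = norm2 u ^ 2 + t ^ 2 * norm2 v ^ 2 := by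
    simp only [norm2_sq, add_dotProduct, dotProduct_add, smul_dotProduct, dotProduct_smul,
      smul_eq_mul, dotProduct_comm v u, huv]
    ring
  have himage (t : ℝ) : norm2 (A.mulVec (u + t • v)) ^ 2 = norm2 (A.mulVec u) ^ 2 +
      2 * t * (A.mulVec u ⬝ᵥ A.mulVec v) + t ^ 2 * norm2 (A.mulVec v) ^ 2 := by
    simp only [norm2_sq, Matrix.mulVec_add, Matrix.mulVec_smul, add_dotProduct, dotProduct_add,
      smul_dotProduct, dotProduct_smul, smul_eq_mul,
      dotProduct_comm (A.mulVec v) (A.mulVec u)]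
    ring
  have hquad (t : ℝ) : 0 ≤ (δ * norm2 v ^ 2) * (t * t) +
      (-2 * (A.mulVec u ⬝ᵥ A.mulVec v)) * t + δ * norm2 u ^ 2 := by
    have h1 := (hA _ (hsupp t)).2
    have h2 := (hA _ (hsupp (-t))).1
    rw [hnorm, himage] at h1 h2
    linarith
  have hdisc := discrim_le_zero hquad
  rw [discrim] at hdisc
  apply abs_le_of_sq_le_sq _
    (mul_nonneg (mul_nonneg hδ (norm2_nonneg _)) (norm2_nonneg _))
  linarith

/-- The cone condition for the error of a vector whose `ℓ₁`-norm does not exceed that of `x`. -/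
theorem sum_compl_abs_sub_le {n : ℕ} {x z : Fin n → ℝ} (hz : norm1 z ≤ norm1 x)
    (Λ : Finset (Fin n)) :
    ∑ i ∈ Λᶜ, |(z - x) i| ≤ ∑ i ∈ Λ, |(z - x) i| + 2 * norm1 (x - restr Λ x) := by
  have hσ : norm1 (x - restr Λ x) = ∑ i ∈ Λᶜ, |x i| := by
    rw [norm1, ← Finset.sum_add_sum_compl Λ]
    rw [Finset.sum_eq_zero (s := Λ) fun i hi => by simp [restr, hi], zero_add]
    exact Finset.sum_congr rfl fun i hi => by simp [restr, Finset.mem_compl.mp hi]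
  have h1 : ∑ i ∈ Λ, |x i| ≤ ∑ i ∈ Λ, |z i| + ∑ i ∈ Λ, |(z - x) i| := by
    rw [← Finset.sum_add_distrib]
    refine Finset.sum_le_sum fun i _ => ?_
    have := abs_sub (z i) (z i - x i)
    simpa using this
  have h2 : ∑ i ∈ Λᶜ, |(z - x) i| ≤ ∑ i ∈ Λᶜ, |z i| + ∑ i ∈ Λᶜ, |x i| := by
    rw [← Finset.sum_add_distrib]
    exact Finset.sum_le_sum fun i _ => abs_sub (z i) (x i)
  rw [norm1, norm1, ← Finset.sum_add_sum_compl Λ, ← Finset.sum_add_sum_compl Λ fun i => |x i|] at hz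
  linarith

theorem sum_abs_le_sqrt_mul_norm2_restr {n k : ℕ} {Λ : Finset (Fin n)} (hΛ : Λ.card ≤ k)
    (h : Fin n → ℝ) : ∑ i ∈ Λ, |h i| ≤ Real.sqrt k * norm2 (restr Λ h) := by
  apply le_of_pow_le_pow_left₀ two_ne_zero (mul_nonneg (Real.sqrt_nonneg _) (norm2_nonneg _))
  rw [mul_pow, Real.sq_sqrt k.cast_nonneg, norm2_restr_sq]
  calc (∑ i ∈ Λ, |h i|) ^ 2 ≤ Λ.card * ∑ i ∈ Λ, |h i| ^ 2 := sq_sum_le_card_mul_sum_sq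
    _ ≤ k * ∑ i ∈ Λ, h i ^ 2 := by
        simp only [sq_abs]
        gcongr

theorem exists_norm1_sub_restr_eq_sInf {n : ℕ} (k : ℕ) (x : Fin n → ℝ) :
    ∃ Λ : Finset (Fin n), Λ.card ≤ k ∧
      sInf {t : ℝ | ∃ Λ : Finset (Fin n), Λ.card ≤ k ∧ t = norm1 (x - restr Λ x)} =
        norm1 (x - restr Λ x) := by
  have hne : {t : ℝ | ∃ Λ : Finset (Fin n), Λ.card ≤ k ∧ t = norm1 (x - restr Λ x)}.Nonempty :=
    ⟨_, ∅, by simp, rfl⟩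
  refine hne.csInf_mem ((Set.finite_range fun Λ => norm1 (x - restr Λ x)).subset ?_)
  rintro t ⟨Λ, -, rfl⟩
  exact ⟨Λ, rfl⟩

/-- The stability estimate behind basis pursuit denoising, for an arbitrary error vector `h`: the
norm of `h` is controlled by `‖A h‖₂` and by the tail of `h` off a `k`-element set `Λ`. -/
theorem RIP.exists_norm2_le {m n k : ℕ} (hk : 0 < k) {A : Matrix (Fin m) (Fin n) ℝ} {δ : ℝ}
    (hδ : 0 ≤ δ) (hA : RIP A (2 * k) δ) {Λ : Finset (Fin n)} (hΛ : Λ.card ≤ k)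
    (h : Fin n → ℝ) :
    ∃ w : ℝ, norm2 (restr Λ h) ≤ w ∧
      norm2 h ≤ w + (∑ i ∈ Λᶜ, |h i|) / Real.sqrt k ∧
      (1 - δ) * w ≤ Real.sqrt (1 + δ) * norm2 (A.mulVec h) +
        Real.sqrt 2 * δ * ((∑ i ∈ Λᶜ, |h i|) / Real.sqrt k) := by
  obtain ⟨T, hTΛ, hTk, hT⟩ := exists_abs_linear_restr_sdiff_le hk h Λᶜ
  have hdisj : Disjoint Λ T := (Finset.subset_compl_iff_disjoint_left).mp hTΛ
  set a := restr Λ h with ha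
  set b := restr T h with hb
  set r := restr (Λᶜ \ T) h with hr
  set τ := (∑ i ∈ Λᶜ, |h i|) / Real.sqrt k with hτ
  have hτ0 : 0 ≤ τ := div_nonneg (Finset.sum_nonneg fun i _ => abs_nonneg _) (Real.sqrt_nonneg _)
  have ha0 : ∀ i ∉ Λ, a i = 0 := fun i hi => restr_apply_of_notMem hi h
  have hb0 : ∀ i ∉ T, b i = 0 := fun i hi => restr_apply_of_notMem hi h
  have hsplit : h = a + b + r := by
    rw [add_assoc, restr_add_restr_sdiff hTΛ]
    ext i
    by_cases hi : i ∈ Λ <;> simp [ha, restr, hi]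
  have hpyth : norm2 (a + b) ^ 2 = norm2 a ^ 2 + norm2 b ^ 2 := by
    have hab := dotProduct_eq_zero_of_disjoint hdisj ha0 hb0
    simp only [norm2_sq, add_dotProduct, dotProduct_add, dotProduct_comm b a, hab]
    ring
  have hna := norm2_nonneg a
  have hnb := norm2_nonneg b
  have hnw := norm2_nonneg (a + b)
  have hnr := norm2_nonneg r
  have haw : norm2 a ≤ norm2 (a + b) := by
    apply le_of_pow_le_pow_left₀ two_ne_zero hnw
    rw [hpyth]
    nlinarith
  have hsum : norm2 a + norm2 b ≤ Real.sqrt 2 * norm2 (a + b) := by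
    apply le_of_pow_le_pow_left₀ two_ne_zero (by positivity)
    rw [mul_pow, Real.sq_sqrt zero_le_two, hpyth]
    nlinarith [sq_nonneg (norm2 a - norm2 b)]
  have hrτ : norm2 r ≤ τ := by
    have h1 := hT (dotProductBilin ℝ ℝ r) (norm2 r) hnr fun U _ _ =>
      abs_dotProduct_le_norm2_mul _ _
    have h2 : |r ⬝ᵥ r| ≤ norm2 r * τ := h1
    rw [← norm2_sq, abs_of_nonneg (sq_nonneg _)] at h2
    rcases hnr.eq_or_lt with h0 | hpos
    · rw [← h0]; exact hτ0
    · exact le_of_mul_le_mul_left (by linarith [sq (norm2 r)]) hpos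
  have hcross : |A.mulVec (a + b) ⬝ᵥ A.mulVec r| ≤ Real.sqrt 2 * δ * norm2 (a + b) * τ := by
    refine hT ((dotProductBilin ℝ ℝ (A.mulVec (a + b))).comp A.mulVecLin) _ (by positivity)
      fun U hU hUk => ?_
    have hu0 : ∀ i ∉ U, restr U h i = 0 := fun i hi => restr_apply_of_notMem hi h
    have hΛU : Disjoint Λ U := Finset.disjoint_left.mpr fun i hi hiU =>
      Finset.mem_compl.mp (Finset.mem_sdiff.mp (hU hiU)).1 hi
    have hTU : Disjoint T U := Finset.disjoint_left.mpr fun i hi hiU =>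
      (Finset.mem_sdiff.mp (hU hiU)).2 hi
    have h1 := hA.abs_dotProduct_le hδ hΛU hΛ hUk ha0 hu0
    have h2 := hA.abs_dotProduct_le hδ hTU hTk hUk hb0 hu0
    have hnu := norm2_nonneg (restr U h)
    change |A.mulVec (a + b) ⬝ᵥ A.mulVec (restr U h)| ≤ _
    rw [Matrix.mulVec_add, add_dotProduct]
    calc _ ≤ δ * norm2 a * norm2 (restr U h) + δ * norm2 b * norm2 (restr U h) :=
          (abs_add_le _ _).trans (add_le_add h1 h2)
      _ = (norm2 a + norm2 b) * (δ * norm2 (restr U h)) := by ring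
      _ ≤ (Real.sqrt 2 * norm2 (a + b)) * (δ * norm2 (restr U h)) := by gcongr
      _ = _ := by ring
  have hsupp : (Finset.univ.filter fun i => (a + b) i ≠ 0).card ≤ 2 * k := by
    refine (Finset.card_le_card (t := Λ ∪ T) fun i hi => ?_).trans
      ((Finset.card_union_le _ _).trans (by omega))
    by_contra hn
    rw [Finset.mem_union, not_or] at hn
    simp [ha0 i hn.1, hb0 i hn.2] at hi
  obtain ⟨hlow, hupp⟩ := hA _ hsupp
  have hAw : norm2 (A.mulVec (a + b)) ≤ Real.sqrt (1 + δ) * norm2 (a + b) := by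
    apply le_of_pow_le_pow_left₀ two_ne_zero (by positivity)
    rwa [mul_pow, Real.sq_sqrt (by linarith)]
  have hmain : norm2 (A.mulVec (a + b)) ^ 2 ≤
      Real.sqrt (1 + δ) * norm2 (a + b) * norm2 (A.mulVec h) +
        Real.sqrt 2 * δ * norm2 (a + b) * τ := by
    have h1 : norm2 (A.mulVec (a + b)) ^ 2 =
        A.mulVec (a + b) ⬝ᵥ A.mulVec h - A.mulVec (a + b) ⬝ᵥ A.mulVec r := by
      rw [norm2_sq, ← dotProduct_sub, ← Matrix.mulVec_sub]
      congr 2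
      exact (sub_eq_of_eq_add hsplit).symm
    have h2 := (le_abs_self _).trans
      (abs_dotProduct_le_norm2_mul (A.mulVec (a + b)) (A.mulVec h))
    have h3 := mul_le_mul_of_nonneg_right hAw (norm2_nonneg (A.mulVec h))
    linarith [neg_le_of_abs_le hcross]
  refine ⟨norm2 (a + b), haw, ?_, ?_⟩
  · calc norm2 h = norm2 (a + b + r) := by rw [← hsplit]
      _ ≤ norm2 (a + b) + norm2 r := norm2_add_le _ _
      _ ≤ norm2 (a + b) + τ := by gcongr
  · rcases hnw.eq_or_lt with h0 | hpos
    · rw [← h0, mul_zero]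
      have := norm2_nonneg (A.mulVec h)
      positivity
    · refine le_of_mul_le_mul_left ?_ hpos
      linarith [sq (norm2 (a + b))]

/-- conventional sparsity, ℓ₂ bound:
`‖x̂ − x‖₂ ≤ (2/√k)·(1+(√2−1)δ)/(1−(1+√2)δ)·σ_k(x,‖·‖₁) + 4√(1+δ)/(1−(1+√2)δ)·ε`. -/
theorem stmt11 {m n k : ℕ} (hk : 0 < k)
    (A : Matrix (Fin m) (Fin n) ℝ)
    (δ : ℝ) (hδ0 : 0 < δ) (hδ : δ < Real.sqrt 2 - 1)
    (hRIP : RIP A (2 * k) δ)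
    -- measurements `y = Ax + η`, `‖η‖₂ ≤ ε`
    (x : Fin n → ℝ) (η : Fin m → ℝ) (ε : ℝ) (hε : 0 ≤ ε) (hη : norm2 η ≤ ε)
    (y : Fin m → ℝ) (hy : y = A.mulVec x + η)
    -- `x̂` minimizes `‖z‖₁` subject to `‖y − Az‖₂ ≤ ε`
    (xh : Fin n → ℝ)
    (hfeas : norm2 (y - A.mulVec xh) ≤ ε)
    (hopt : ∀ z : Fin n → ℝ, norm2 (y - A.mulVec z) ≤ ε → norm1 xh ≤ norm1 z)
    -- the `k`-sparsity index `σ = σ_k(x, ‖·‖₁)`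
    (σ : ℝ)
    (hσ : σ = sInf {t : ℝ | ∃ Λ : Finset (Fin n), Λ.card ≤ k ∧ t = norm1 (x - restr Λ x)}) :
    norm2 (xh - x)
      ≤ (2 / Real.sqrt k)
          * ((1 + (Real.sqrt 2 - 1) * δ) / (1 - (1 + Real.sqrt 2) * δ)) * σ
        + (4 * Real.sqrt (1 + δ) / (1 - (1 + Real.sqrt 2) * δ)) * ε := by
  obtain ⟨Λ, hΛ, hΛσ⟩ := exists_norm1_sub_restr_eq_sInf k x
  rw [← hσ] at hΛσ
  obtain ⟨w, haw, hw, hbound⟩ := hRIP.exists_norm2_le hk hδ0.le hΛ (xh - x)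
  have hxη : y - A.mulVec x = η := by rw [hy, add_sub_cancel_left]
  have hcone := sum_compl_abs_sub_le (hopt x (by rwa [hxη])) Λ
  have hΛ1 := sum_abs_le_sqrt_mul_norm2_restr hΛ (xh - x)
  rw [← hΛσ] at hcone
  have hAh : norm2 (A.mulVec (xh - x)) ≤ 2 * ε := by
    have h1 : A.mulVec (xh - x) = η - (y - A.mulVec xh) := by
      rw [Matrix.mulVec_sub, hy]
      abel
    rw [h1]
    linarith [norm2_sub_le η (y - A.mulVec xh)]
  have hs : 0 < Real.sqrt k := Real.sqrt_pos.mpr (Nat.cast_pos.mpr hk)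
  have hs2 : Real.sqrt 2 ^ 2 = 2 := Real.sq_sqrt zero_le_two
  have hD : 0 < 1 - (1 + Real.sqrt 2) * δ := by
    nlinarith [Real.sqrt_nonneg 2]
  set τ := (∑ i ∈ Λᶜ, |(xh - x) i|) / Real.sqrt k
  have hτ : τ ≤ w + 2 * (σ / Real.sqrt k) := by
    rw [div_le_iff₀ hs, add_mul, mul_assoc, div_mul_cancel₀ _ hs.ne']
    linarith [mul_le_mul_of_nonneg_left haw hs.le]
  have hsq := mul_le_mul_of_nonneg_left hAh (Real.sqrt_nonneg (1 + δ))
  have hsτ := mul_le_mul_of_nonneg_left hτ (mul_nonneg (Real.sqrt_nonneg 2) hδ0.le)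
  have hfinal : norm2 (xh - x) * (1 - (1 + Real.sqrt 2) * δ) ≤
      2 * (1 + (Real.sqrt 2 - 1) * δ) * (σ / Real.sqrt k) + 4 * Real.sqrt (1 + δ) * ε := by
    have h1 : norm2 (xh - x) ≤ 2 * w + 2 * (σ / Real.sqrt k) := by linarith
    linarith [mul_le_mul_of_nonneg_right h1 hD.le]
  calc norm2 (xh - x) ≤ (2 * (1 + (Real.sqrt 2 - 1) * δ) * (σ / Real.sqrt k) +
        4 * Real.sqrt (1 + δ) * ε) / (1 - (1 + Real.sqrt 2) * δ) := (le_div_iff₀ hD).mpr hfinal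
    _ = _ := by
      field_simp
end
end
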